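/- Let k be a field, A a Hopf algebra over k with antipode S, v ∈ M_N(A) a corepresentation matrix whose entries v_{ij} (1 ≤ i,j ≤ N) are linearly independent over k, and E ∈ M_N(k) invertible with S(v) = E^{-1} v^T E. If b_3(c_V) = 0, where c_V := Σ_{i,j,k,l} S(v_{ji}) ⊗ v_{ik} ⊗ S(v_{kl}) ⊗ v_{lj} + Σ_{i,j} 1 ⊗ v_{ij} ⊗ 1 ⊗ S(v_{ji}), then E is symmetric or antisymmetric: E^T = E or E^T = −E. -/

import Mathlib

open TensorProduct Matrix

noncomputable section

variable (k A : Type*) [Field k] [Ring A] [HopfAlgebra k A]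

/-- Multiply the first two tensor factors of `A ⊗ (A ⊗ M)`. -/
def mulFirst (M : Type*) [AddCommGroup M] [Module k M] :
    A ⊗[k] (A ⊗[k] M) →ₗ[k] A ⊗[k] M :=
  (TensorProduct.map (LinearMap.mul' k A) LinearMap.id) ∘ₗ
    (TensorProduct.assoc k A A M).symm.toLinearMap

/-- `A^{⊗3} ≃ A^{⊗2} ⊗ A`, pulling the last factor out. -/
def pull3 : A ⊗[k] (A ⊗[k] A) ≃ₗ[k] (A ⊗[k] A) ⊗[k] A :=
  (TensorProduct.assoc k A A A).symm

/-- `A^{⊗4} ≃ A^{⊗3} ⊗ A`, pulling the last factor out. -/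
def pull4 : A ⊗[k] (A ⊗[k] (A ⊗[k] A)) ≃ₗ[k] (A ⊗[k] (A ⊗[k] A)) ⊗[k] A :=
  (TensorProduct.congr (LinearEquiv.refl k A) (pull3 k A)).trans
    (TensorProduct.assoc k A (A ⊗[k] A) A).symm

/-- Cyclic rotation `a₀ ⊗ a₁ ⊗ a₂ ⊗ a₃ ↦ a₃ ⊗ a₀ ⊗ a₁ ⊗ a₂` of `A^{⊗4}`. -/
def rotate4 : A ⊗[k] (A ⊗[k] (A ⊗[k] A)) ≃ₗ[k] A ⊗[k] (A ⊗[k] (A ⊗[k] A)) :=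
  (pull4 k A).trans (TensorProduct.comm k (A ⊗[k] (A ⊗[k] A)) A)

/-- The Hochschild boundary `b₃ : A^{⊗4} → A^{⊗3}`,
`a₀⊗a₁⊗a₂⊗a₃ ↦ a₀a₁⊗a₂⊗a₃ - a₀⊗a₁a₂⊗a₃ + a₀⊗a₁⊗a₂a₃ - a₃a₀⊗a₁⊗a₂`. -/
def hochschildB3 : A ⊗[k] (A ⊗[k] (A ⊗[k] A)) →ₗ[k] A ⊗[k] (A ⊗[k] A) :=
  mulFirst k A (A ⊗[k] A)
  - TensorProduct.map (LinearMap.id : A →ₗ[k] A) (mulFirst k A A)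
  + TensorProduct.map (LinearMap.id : A →ₗ[k] A)
      (TensorProduct.map (LinearMap.id : A →ₗ[k] A) (LinearMap.mul' k A))
  - (mulFirst k A (A ⊗[k] A)) ∘ₗ (rotate4 k A).toLinearMap

/-- `S(v) v = 1` for a corepresentation matrix `v`. -/
theorem sum_antipode_mul_of_comul {n : Type*} [Fintype n] [DecidableEq n] (v : Matrix n n A)
    (hΔ : ∀ i j, Coalgebra.comul (R := k) (v i j) = ∑ l, v i l ⊗ₜ[k] v l j)
    (hε : ∀ i j, Coalgebra.counit (R := k) (v i j) = if i = j then 1 else 0) (i j : n) :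
    ∑ l, HopfAlgebra.antipode (R := k) (v i l) * v l j = if i = j then 1 else 0 := by
  have h := HopfAlgebra.mul_antipode_rTensor_comul_apply (R := k) (v i j)
  rw [hΔ, hε] at h
  simpa [apply_ite] using h

/-- `v S(v) = 1` for a corepresentation matrix `v`. -/
theorem sum_mul_antipode_of_comul {n : Type*} [Fintype n] [DecidableEq n] (v : Matrix n n A)
    (hΔ : ∀ i j, Coalgebra.comul (R := k) (v i j) = ∑ l, v i l ⊗ₜ[k] v l j)
    (hε : ∀ i j, Coalgebra.counit (R := k) (v i j) = if i = j then 1 else 0) (i j : n) :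
    ∑ l, v i l * HopfAlgebra.antipode (R := k) (v l j) = if i = j then 1 else 0 := by
  have h := HopfAlgebra.mul_antipode_lTensor_comul_apply (R := k) (v i j)
  rw [hΔ, hε] at h
  simpa [apply_ite] using h

@[simp]
theorem hochschildB3_tmul (a b c d : A) :
    hochschildB3 k A (a ⊗ₜ[k] (b ⊗ₜ[k] (c ⊗ₜ[k] d))) =
      (a * b) ⊗ₜ[k] (c ⊗ₜ[k] d) - a ⊗ₜ[k] ((b * c) ⊗ₜ[k] d) + a ⊗ₜ[k] (b ⊗ₜ[k] (c * d))
        - (d * a) ⊗ₜ[k] (b ⊗ₜ[k] c) := by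
  simp [hochschildB3, mulFirst, rotate4, pull4, pull3]

/-- The boundary of `Σ S(v_{ji}) ⊗ v_{il} ⊗ S(v_{lm}) ⊗ v_{mj}`. -/
theorem hochschildB3_sum_antipode_tmul {n : Type*} [Fintype n] [DecidableEq n] (v : Matrix n n A)
    (hΔ : ∀ i j, Coalgebra.comul (R := k) (v i j) = ∑ l, v i l ⊗ₜ[k] v l j)
    (hε : ∀ i j, Coalgebra.counit (R := k) (v i j) = if i = j then 1 else 0) :
    hochschildB3 k A (∑ i, ∑ j, ∑ l, ∑ m, HopfAlgebra.antipode (R := k) (v j i) ⊗ₜ[k]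
        (v i l ⊗ₜ[k] (HopfAlgebra.antipode (R := k) (v l m) ⊗ₜ[k] v m j))) =
      (∑ i, ∑ j, (1 : A) ⊗ₜ[k] (HopfAlgebra.antipode (R := k) (v i j) ⊗ₜ[k] v j i))
      - (∑ i, ∑ j, HopfAlgebra.antipode (R := k) (v i j) ⊗ₜ[k] ((1 : A) ⊗ₜ[k] v j i))
      + (∑ i, ∑ j, HopfAlgebra.antipode (R := k) (v i j) ⊗ₜ[k] (v j i ⊗ₜ[k] (1 : A)))
      - ∑ i, ∑ j, (1 : A) ⊗ₜ[k] (v i j ⊗ₜ[k] HopfAlgebra.antipode (R := k) (v j i)) := by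
  have hSv := sum_antipode_mul_of_comul k A v hΔ hε
  have hvS := sum_mul_antipode_of_comul k A v hΔ hε
  simp only [map_sum, hochschildB3_tmul, Finset.sum_add_distrib, Finset.sum_sub_distrib]
  congr 1
  · congr 1
    · congr 1
      · have h (j l m : n) : ∑ i, (HopfAlgebra.antipode (R := k) (v j i) * v i l) ⊗ₜ[k]
            (HopfAlgebra.antipode (R := k) (v l m) ⊗ₜ[k] v m j) =
            if j = l then (1 : A) ⊗ₜ[k] (HopfAlgebra.antipode (R := k) (v l m) ⊗ₜ[k] v m j)
            else 0 := by
          rw [← TensorProduct.sum_tmul, hSv]; split_ifs <;> simp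
        rw [Finset.sum_comm]
        refine Finset.sum_congr rfl fun j _ => ?_
        refine (Finset.sum_comm.trans (Finset.sum_congr rfl fun l _ => Finset.sum_comm)).trans ?_
        simp_rw [h]
        rw [Finset.sum_comm]
        simp
      · rw [Finset.sum_comm]
        refine Finset.sum_congr rfl fun j _ => Finset.sum_congr rfl fun i _ => ?_
        rw [Finset.sum_comm]
        simp_rw [← TensorProduct.tmul_sum, ← TensorProduct.sum_tmul, hvS]
        simp [TensorProduct.ite_tmul]
    · rw [Finset.sum_comm]
      refine Finset.sum_congr rfl fun j _ => Finset.sum_congr rfl fun i _ => ?_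
      simp_rw [← TensorProduct.tmul_sum, hSv]
      simp [TensorProduct.tmul_ite]
  · refine Finset.sum_congr rfl fun i _ => ?_
    have h (l m : n) : ∑ j, (v m j * HopfAlgebra.antipode (R := k) (v j i)) ⊗ₜ[k]
        (v i l ⊗ₜ[k] HopfAlgebra.antipode (R := k) (v l m)) =
        if m = i then (1 : A) ⊗ₜ[k] (v i l ⊗ₜ[k] HopfAlgebra.antipode (R := k) (v l m))
        else 0 := by
      rw [← TensorProduct.sum_tmul, hvS]; split_ifs <;> simp
    rw [Finset.sum_comm]
    refine Finset.sum_congr rfl fun l _ => ?_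
    rw [Finset.sum_comm]
    simp_rw [h]
    simp

/-- If `1 ⊗ X - X₁₃ = 1 ⊗ Y - Y₁₃` for `X = Σ S(v_{ij}) ⊗ v_{ji}` and `Y = Σ v_{ij} ⊗ S(v_{ji})`,
then `X = Y`. -/
theorem sum_antipode_tmul_eq_of_one_tmul {n : Type*} [Fintype n] [DecidableEq n]
    (v : Matrix n n A)
    (hε : ∀ i j, Coalgebra.counit (R := k) (v i j) = if i = j then 1 else 0)
    (h : (∑ i, ∑ j, (1 : A) ⊗ₜ[k] (HopfAlgebra.antipode (R := k) (v i j) ⊗ₜ[k] v j i))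
      - (∑ i, ∑ j, HopfAlgebra.antipode (R := k) (v i j) ⊗ₜ[k] ((1 : A) ⊗ₜ[k] v j i))
      = (∑ i, ∑ j, (1 : A) ⊗ₜ[k] (v i j ⊗ₜ[k] HopfAlgebra.antipode (R := k) (v j i)))
      - ∑ i, ∑ j, v i j ⊗ₜ[k] ((1 : A) ⊗ₜ[k] HopfAlgebra.antipode (R := k) (v j i))) :
    ∑ i, ∑ j, HopfAlgebra.antipode (R := k) (v i j) ⊗ₜ[k] v j i =
      ∑ i, ∑ j, v i j ⊗ₜ[k] HopfAlgebra.antipode (R := k) (v j i) := by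
  have h₁ := congrArg (fun x => TensorProduct.lid k (A ⊗[k] A)
    ((Coalgebra.counit (R := k) (A := A)).rTensor (A ⊗[k] A) x)) h
  simp only [map_sub, map_sum, LinearMap.rTensor_tmul, TensorProduct.lid_tmul,
    Bialgebra.counit_one, HopfAlgebra.counit_antipode, hε, one_smul, ite_smul, zero_smul,
    Finset.sum_ite_eq, Finset.mem_univ, if_true] at h₁
  have h₂ := congrArg (fun x => TensorProduct.rid k A
    ((Coalgebra.counit (R := k) (A := A)).lTensor A x)) h₁
  simp only [map_sub, map_sum, LinearMap.lTensor_tmul, TensorProduct.rid_tmul,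
    HopfAlgebra.counit_antipode, hε, one_smul, ite_smul, zero_smul,
    Finset.sum_ite_eq', Finset.mem_univ, if_true, sub_left_inj] at h₂
  simp_rw [← TensorProduct.tmul_sum, h₂] at h₁
  exact sub_left_inj.mp h₁

theorem sum_reverse_order {n M : Type*} [Fintype n] [AddCommMonoid M] (f : n → n → n → n → M) :
    ∑ a, ∑ b, ∑ c, ∑ d, f a b c d = ∑ d, ∑ c, ∑ b, ∑ a, f a b c d := by
  have h (g : n → n → n → M) : ∑ b, ∑ c, ∑ d, g b c d = ∑ d, ∑ c, ∑ b, g b c d := by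
    rw [Finset.sum_comm, Finset.sum_congr rfl fun c _ => Finset.sum_comm]
    exact Finset.sum_comm
  rw [Finset.sum_congr rfl fun a _ => h (f a), Finset.sum_comm]
  refine Finset.sum_congr rfl fun d _ => ?_
  rw [Finset.sum_comm]
  exact Finset.sum_congr rfl fun c _ => Finset.sum_comm

/-- A matrix `E` with `F ⊗ E = Fᵀ ⊗ Eᵀ` for some nonzero `F` is symmetric or antisymmetric. -/
theorem transpose_eq_or_eq_neg_of_mul_eq {K n : Type*} [Field K] (E F : Matrix n n K) (hF : F ≠ 0)
    (h : ∀ a b i j, F i a * E b j = F a i * E j b) : Eᵀ = E ∨ Eᵀ = -E := by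
  obtain ⟨i, a, hia⟩ : ∃ i a, F i a ≠ 0 := by
    by_contra! h0
    exact hF (Matrix.ext h0)
  have hsq : F i a * F i a = F a i * F a i ∨ E = 0 := by
    refine or_iff_not_imp_right.mpr fun hE => ?_
    obtain ⟨b, j, hbj⟩ : ∃ b j, E b j ≠ 0 := by
      by_contra! h0
      exact hE (Matrix.ext h0)
    refine mul_right_cancel₀ hbj ?_
    linear_combination F i a * h a b i j + F a i * h a j i b
  rcases hsq with hsq | rfl
  · rcases mul_self_eq_mul_self_iff.mp hsq with hs | hs
    · left
      ext b j
      refine mul_left_cancel₀ hia ?_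
      rw [Matrix.transpose_apply, h a j i b, ← hs]
    · right
      ext b j
      refine mul_left_cancel₀ hia ?_
      rw [Matrix.transpose_apply, Matrix.neg_apply, h a j i b, hs]
      ring
  · simp

/-- if `v` is a corepresentation matrix of a Hopf algebra `A` whose entries
are linearly independent over `k`, `E ∈ Mₙ(k)` is invertible with `S(v) = E⁻¹ vᵀ E`, and
`c_V := Σ S(v_{ji}) ⊗ v_{ik} ⊗ S(v_{kl}) ⊗ v_{lj} + Σ 1 ⊗ v_{ij} ⊗ 1 ⊗ S(v_{ji})` satisfies
`b₃(c_V) = 0`, then `E` is symmetric or antisymmetric. -/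
theorem symm_or_antisymm_of_hochschildB3_cV_eq_zero (N : ℕ)
    (v : Matrix (Fin N) (Fin N) A)
    (hΔ : ∀ i j, Coalgebra.comul (R := k) (v i j) = ∑ l, v i l ⊗ₜ[k] v l j)
    (hε : ∀ i j, Coalgebra.counit (R := k) (v i j) = if i = j then 1 else 0)
    (hlin : LinearIndependent k (fun p : Fin N × Fin N => v p.1 p.2))
    (E : Matrix (Fin N) (Fin N) k) (hE : IsUnit E)
    (hSv : ∀ l m, HopfAlgebra.antipode (R := k) (v l m)
      = ∑ j, ∑ s, (E⁻¹ l j * E s m) • v s j)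
    (hcycle : hochschildB3 k A
      ((∑ i, ∑ j, ∑ l, ∑ m, HopfAlgebra.antipode (R := k) (v j i) ⊗ₜ[k]
          (v i l ⊗ₜ[k] (HopfAlgebra.antipode (R := k) (v l m) ⊗ₜ[k] v m j)))
        + ∑ i, ∑ j, (1 : A) ⊗ₜ[k]
            (v i j ⊗ₜ[k] ((1 : A) ⊗ₜ[k] HopfAlgebra.antipode (R := k) (v j i))))
      = 0) :
    Eᵀ = E ∨ Eᵀ = -E := by
  rcases eq_or_ne E⁻¹ 0 with hE₀ | hE₀
  · have : E = 0 := by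
      rw [← Matrix.nonsing_inv_nonsing_inv E ((Matrix.isUnit_iff_isUnit_det E).mp hE), hE₀]
      simp
    simp [this]
  refine transpose_eq_or_eq_neg_of_mul_eq E E⁻¹ hE₀ fun a b i j => ?_
  rw [map_add, hochschildB3_sum_antipode_tmul k A v hΔ hε] at hcycle
  simp only [map_sum, hochschildB3_tmul, Finset.sum_add_distrib, Finset.sum_sub_distrib,
    one_mul, mul_one] at hcycle
  have hXY := sum_antipode_tmul_eq_of_one_tmul k A v hε (by
    have hc : ∑ i, ∑ j, HopfAlgebra.antipode (R := k) (v i j) ⊗ₜ[k] (v j i ⊗ₜ[k] (1 : A)) =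
        ∑ i, ∑ j, HopfAlgebra.antipode (R := k) (v j i) ⊗ₜ[k] (v i j ⊗ₜ[k] (1 : A)) :=
      Finset.sum_comm
    rw [hc] at hcycle
    rw [← sub_eq_zero, ← hcycle]
    abel)
  refine (hlin.tmul_of_isDomain hlin).eq_coords_of_eq
    (f := fun p => E⁻¹ p.2.2 p.1.2 * E p.1.1 p.2.1)
    (g := fun p => E⁻¹ p.1.2 p.2.2 * E p.2.1 p.1.1) ?_ ((b, a), (j, i))
  simp only [hSv, TensorProduct.sum_tmul, TensorProduct.tmul_sum, TensorProduct.smul_tmul',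
    TensorProduct.tmul_smul] at hXY
  simp only [Fintype.sum_prod_type]
  refine Eq.trans ?_ (hXY.trans ?_)
  · rw [sum_reverse_order]
    simp only [TensorProduct.smul_tmul']
  · refine Finset.sum_congr rfl fun i _ => Finset.sum_congr rfl fun j _ => ?_
    rw [Finset.sum_comm]
    simp only [TensorProduct.smul_tmul']

end
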